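/- Let N ≥ 2, p > 1 and s > p/(p−1), and let u be the function of Example 1.1 built from the data in the context. Then u ∈ C^1(closure(B₆)), u > 0 in B₆, u = 0 on ∂B₆, u is not radially symmetric with respect to the origin (there is no function U with u(x) = U(|x|) for all x ∈ B₆), and there exists a function f ∈ C([0,2)) ∩ C^∞((0,1) ∪ (1,2)) with f(1) = 0 such that u is a distributional solution of −div(|∇u|^{p−2}∇u) = f(u) in B₆, i.e. ∫_{B₆} |∇u|^{p−2} ∇u·∇φ dx = ∫_{B₆} f(u) φ dx for all φ ∈ C_c^∞(B₆). -/

import Mathlib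

open Set Metric MeasureTheory Bornology
open scoped RealInnerProductSpace Classical

noncomputable section

/-- The vector field `y ↦ (g(|y|)/|y|)·y`, with the convention that it vanishes at `y = 0`. -/
def gvec {N : ℕ} (g : ℝ → ℝ) (y : EuclideanSpace ℝ (Fin N)) : EuclideanSpace ℝ (Fin N) :=
  if y = 0 then 0 else (g ‖y‖ / ‖y‖) • y

/-- `φ` is a smooth test function compactly supported in `Ω`. -/
def IsTestFun {N : ℕ} (Ω : Set (EuclideanSpace ℝ (Fin N)))
    (φ : EuclideanSpace ℝ (Fin N) → ℝ) : Prop :=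
  ContDiff ℝ (⊤ : ℕ∞) φ ∧ HasCompactSupport φ ∧ tsupport φ ⊆ Ω

/-- Conditions (2.1)-(2.2): `g ∈ C[0,∞) ∩ C¹(0,∞)`, `g(0) = 0`, `g'(t) > 0` for `t > 0`. -/
def GCond (g : ℝ → ℝ) : Prop :=
  ContinuousOn g (Ici 0) ∧ ContDiffOn ℝ 1 g (Ioi 0) ∧ g 0 = 0 ∧
    ∀ t : ℝ, 0 < t → 0 < deriv g t

/-- Conditions (2.3)-(2.4): `f ∈ C([0,R] × [0,∞))`, `r ↦ f(r,t)` non-increasing. -/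
def FCond (R : ℝ) (f : ℝ → ℝ → ℝ) : Prop :=
  ContinuousOn (fun q : ℝ × ℝ => f q.1 q.2) (Icc 0 R ×ˢ Ici 0) ∧
    ∀ t : ℝ, 0 ≤ t → ∀ r₁ ∈ Icc (0:ℝ) R, ∀ r₂ ∈ Icc (0:ℝ) R, r₁ ≤ r₂ → f r₂ t ≤ f r₁ t

/-- `u` solves `-div((g(|∇u|)/|∇u|)∇u) = f(|x|,u)` distributionally in the ball `B_R`. -/
def IsDistribSolBall {N : ℕ} (R : ℝ) (g : ℝ → ℝ) (f : ℝ → ℝ → ℝ)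
    (u : EuclideanSpace ℝ (Fin N) → ℝ) : Prop :=
  ∀ φ : EuclideanSpace ℝ (Fin N) → ℝ, IsTestFun (ball 0 R) φ →
    (∫ x in ball (0:EuclideanSpace ℝ (Fin N)) R, ⟪gvec g (gradient u x), gradient φ x⟫) =
      ∫ x in ball (0:EuclideanSpace ℝ (Fin N)) R, f ‖x‖ (u x) * φ x

/-- `u` is a weak solution of problem (P): `u ∈ C¹(clos B_R)`, `u ≥ 0`, `u ≢ 0`,
`u = 0` on `∂B_R`, and the equation holds distributionally. -/
def IsWeakSolP {N : ℕ} (R : ℝ) (g : ℝ → ℝ) (f : ℝ → ℝ → ℝ)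
    (u : EuclideanSpace ℝ (Fin N) → ℝ) : Prop :=
  ContDiffOn ℝ 1 u (closedBall 0 R) ∧
  (∀ x ∈ closedBall (0:EuclideanSpace ℝ (Fin N)) R, 0 ≤ u x) ∧
  (∃ x ∈ closedBall (0:EuclideanSpace ℝ (Fin N)) R, u x ≠ 0) ∧
  (∀ x ∈ sphere (0:EuclideanSpace ℝ (Fin N)) R, u x = 0) ∧
  IsDistribSolBall R g f u

/-- `U` is `C¹` on `[a,b]` with (continuous) derivative `U'`. -/
def C1On (U U' : ℝ → ℝ) (a b : ℝ) : Prop :=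
  ContinuousOn U' (Icc a b) ∧ ∀ r ∈ Icc a b, HasDerivWithinAt U (U' r) (Icc a b) r

/-- Definition 2.1: `u` is locally symmetric in `B_R`. -/
def LocallySymmetric {N : ℕ} (R : ℝ) (u : EuclideanSpace ℝ (Fin N) → ℝ) : Prop :=
  ∃ (K : Set ℕ) (z : ℕ → EuclideanSpace ℝ (Fin N)) (ri ro : ℕ → ℝ) (U U' : ℕ → ℝ → ℝ),
    (∀ k ∈ K, z k ∈ ball (0:EuclideanSpace ℝ (Fin N)) R ∧ 0 ≤ ri k ∧ ri k < ro k) ∧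
    K.PairwiseDisjoint (fun k => ball (z k) (ro k) \ closedBall (z k) (ri k)) ∧
    ball (0:EuclideanSpace ℝ (Fin N)) R =
      (⋃ k ∈ K, ball (z k) (ro k) \ closedBall (z k) (ri k)) ∪
        {x ∈ ball (0:EuclideanSpace ℝ (Fin N)) R | gradient u x = 0} ∧
    ∀ k ∈ K,
      C1On (U k) (U' k) (ri k) (ro k) ∧
      (∀ x ∈ ball (z k) (ro k) \ closedBall (z k) (ri k), u x = U k ‖x - z k‖) ∧
      (∀ r ∈ Ioo (ri k) (ro k), U' k r < 0) ∧
      (∀ x ∈ ball (z k) (ri k), U k (ri k) ≤ u x)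

/-- `H(t) = t·g(t) - ∫₀ᵗ g(s) ds`. -/
def Hfun (g : ℝ → ℝ) (t : ℝ) : ℝ := t * g t - ∫ s in (0:ℝ)..t, g s

/-- The inverse of `H` on `[0,∞)`. -/
def Hinv (g : ℝ → ℝ) : ℝ → ℝ := Function.invFunOn (Hfun g) (Ici 0)

/-- The class `A_g` of Definition 3.1. -/
def MemAg (g φ : ℝ → ℝ) : Prop :=
  ContinuousOn φ (Ici 0) ∧ (∀ t : ℝ, 0 ≤ t → 0 ≤ φ t) ∧ φ 0 = 0 ∧
  ((∃ d > (0:ℝ), ∀ t ∈ Icc (0:ℝ) d, φ t = 0) ∨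
    ∃ δ > (0:ℝ), (∀ t ∈ Ioo (0:ℝ) δ, 0 < φ t) ∧
      ∫⁻ t in Ioc (0:ℝ) δ, ENNReal.ofReal (1 / Hinv g (∫ s in (0:ℝ)..t, φ s)) = ⊤)

/-- `u` satisfies `div((g(|∇u|)/|∇u|)∇u) ≤ φ(u)` distributionally in `Ω`. -/
def DistribSupIneq {N : ℕ} (Ω : Set (EuclideanSpace ℝ (Fin N))) (g φ : ℝ → ℝ)
    (u : EuclideanSpace ℝ (Fin N) → ℝ) : Prop :=
  ∀ ψ : EuclideanSpace ℝ (Fin N) → ℝ, IsTestFun Ω ψ → (∀ x, 0 ≤ ψ x) →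
    -(∫ x in Ω, ⟪gvec g (gradient u x), gradient ψ x⟫) ≤ ∫ x in Ω, φ (u x) * ψ x

/-- Condition (a) of Lemma 3.7. -/
def CondA (R : ℝ) (g : ℝ → ℝ) (f : ℝ → ℝ → ℝ) : Prop :=
  ∀ ρ ∈ Ico (0:ℝ) R, ∀ τ : ℝ, 0 < τ → f ρ τ = 0 →
    ∃ δ ∈ Ioo (0:ℝ) τ, ∃ φ : ℝ → ℝ, MemAg g φ ∧
      ∀ t ∈ Icc (τ - δ) τ, ∀ r ∈ Icc (ρ - δ) (ρ + δ) ∩ Icc (0:ℝ) R, f r t ≤ φ (τ - t)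

/-- Condition (b) of Lemma 3.8. -/
def CondB (R : ℝ) (g : ℝ → ℝ) (f : ℝ → ℝ → ℝ) : Prop :=
  ∀ ρ ∈ Ico (0:ℝ) R, f ρ 0 = 0 →
    ∃ δ > (0:ℝ), ∃ φ : ℝ → ℝ, MemAg g φ ∧
      ∀ r ∈ Ico (0:ℝ) R, ∀ t ∈ Icc (0:ℝ) δ, -f r t ≤ φ t

/-- Condition (c) of Theorem 3.9. -/
def CondC (R : ℝ) (g : ℝ → ℝ) (f : ℝ → ℝ → ℝ) : Prop :=
  ∀ ρ ∈ Ico (0:ℝ) R, ∀ τ : ℝ, 0 ≤ τ → f ρ τ = 0 →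
    ∃ δ > (0:ℝ), ∃ φ : ℝ → ℝ, MemAg g φ ∧
      ∀ t ∈ Icc τ (τ + δ), ∀ r ∈ Icc (ρ - δ) (ρ + δ) ∩ Icc (0:ℝ) R, -f r t ≤ φ (t - τ)

/-- `u` solves `-div((g(|∇u|)/|∇u|)∇u) = f(u)` distributionally in `Ω` (autonomous case). -/
def IsDistribSolAut {N : ℕ} (Ω : Set (EuclideanSpace ℝ (Fin N))) (g f : ℝ → ℝ)
    (u : EuclideanSpace ℝ (Fin N) → ℝ) : Prop :=
  ∀ φ : EuclideanSpace ℝ (Fin N) → ℝ, IsTestFun Ω φ →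
    (∫ x in Ω, ⟪gvec g (gradient u x), gradient φ x⟫) = ∫ x in Ω, f (u x) * φ x

/-- `u` is a weak solution of problem (P) with autonomous right-hand side `f = f(u)`. -/
def IsWeakSolPAut {N : ℕ} (R : ℝ) (g f : ℝ → ℝ) (u : EuclideanSpace ℝ (Fin N) → ℝ) : Prop :=
  ContDiffOn ℝ 1 u (closedBall 0 R) ∧
  (∀ x ∈ closedBall (0:EuclideanSpace ℝ (Fin N)) R, 0 ≤ u x) ∧
  (∃ x ∈ closedBall (0:EuclideanSpace ℝ (Fin N)) R, u x ≠ 0) ∧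
  (∀ x ∈ sphere (0:EuclideanSpace ℝ (Fin N)) R, u x = 0) ∧
  IsDistribSolAut (ball 0 R) g f u

/-- `G(t) = ∫₀ᵗ g(s) ds`. -/
def Gfun (g : ℝ → ℝ) (t : ℝ) : ℝ := ∫ s in (0:ℝ)..t, g s

/-- The variational functional `J(v) = ∫_Ω (G(|∇v|) - F(v)) dx`. -/
def Jfun {N : ℕ} (g f : ℝ → ℝ) (Ω : Set (EuclideanSpace ℝ (Fin N)))
    (v : EuclideanSpace ℝ (Fin N) → ℝ) : ℝ :=
  ∫ x in Ω, (Gfun g ‖gradient v x‖ - Gfun f (v x))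

/-- `v ∈ X`, i.e. `v ∈ C¹(clos Ω)` with `v = 0` on `∂Ω`. -/
def MemX {N : ℕ} (Ω : Set (EuclideanSpace ℝ (Fin N)))
    (v : EuclideanSpace ℝ (Fin N) → ℝ) : Prop :=
  ContDiffOn ℝ 1 v (closure Ω) ∧ ∀ x ∈ frontier Ω, v x = 0

/-- `u` is a global minimizer of `J` in `X`. -/
def IsGlobalMinJ {N : ℕ} (g f : ℝ → ℝ) (Ω : Set (EuclideanSpace ℝ (Fin N)))
    (u : EuclideanSpace ℝ (Fin N) → ℝ) : Prop :=
  MemX Ω u ∧ ∀ v, MemX Ω v → Jfun g f Ω u ≤ Jfun g f Ω v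

/-- `u` is a local minimizer of `J` in `X` (w.r.t. the `C¹` distance). -/
def IsLocalMinJ {N : ℕ} (g f : ℝ → ℝ) (Ω : Set (EuclideanSpace ℝ (Fin N)))
    (u : EuclideanSpace ℝ (Fin N) → ℝ) : Prop :=
  MemX Ω u ∧ ∃ ε > (0:ℝ), ∀ v, MemX Ω v →
    (∀ x ∈ Ω, |v x - u x| + ‖gradient v x - gradient u x‖ < ε) →
    Jfun g f Ω u ≤ Jfun g f Ω v

/-- `Ω` has `C¹` boundary: near every boundary point, `Ω` is the sublevel set of a `C¹`
defining function with nonvanishing gradient. -/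
def HasC1Boundary {N : ℕ} (Ω : Set (EuclideanSpace ℝ (Fin N))) : Prop :=
  ∀ y ∈ frontier Ω, ∃ (V : Set (EuclideanSpace ℝ (Fin N))) (ρ : EuclideanSpace ℝ (Fin N) → ℝ),
    IsOpen V ∧ y ∈ V ∧ ContDiffOn ℝ 1 ρ V ∧ (∀ x ∈ V, (x ∈ Ω ↔ ρ x < 0)) ∧ gradient ρ y ≠ 0

/-- The Neumann condition `∂u/∂ν = 0` on `∂Ω`; for `u ∈ X` (so that `u` vanishes on the
boundary and all tangential derivatives vanish) this is equivalent to the vanishing of the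
full derivative of `u` (within `clos Ω`) at every boundary point. -/
def NeumannZero {N : ℕ} (Ω : Set (EuclideanSpace ℝ (Fin N)))
    (u : EuclideanSpace ℝ (Fin N) → ℝ) : Prop :=
  ∀ y ∈ frontier Ω, HasFDerivWithinAt u (0 : EuclideanSpace ℝ (Fin N) →L[ℝ] ℝ) (closure Ω) y

/-- `u` is radially symmetric and radially non-increasing on `clos B_R`, with `C¹`
profile `U` (with derivative `U'`). -/
def RadialNonincreasing {N : ℕ} (R : ℝ) (u : EuclideanSpace ℝ (Fin N) → ℝ)
    (U U' : ℝ → ℝ) : Prop :=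
  C1On U U' 0 R ∧ AntitoneOn U (Icc 0 R) ∧
    ∀ x ∈ closedBall (0:EuclideanSpace ℝ (Fin N)) R, u x = U ‖x‖

end

noncomputable section

/-- The bump `w` of Example 1.1: `w(x) = (1-|x|²)^s` for `|x| ≤ 1`, `w(x) = 0` otherwise. -/
def wEx {N : ℕ} (s : ℝ) (x : EuclideanSpace ℝ (Fin N)) : ℝ :=
  if ‖x‖ ≤ 1 then (1 - ‖x‖ ^ 2) ^ s else 0

/-- The plateau function `v` of Example 1.1: `v(x) = 1` for `|x| < 5`,
`v(x) = 1 - ((|x|²-25)/11)^s` for `5 ≤ |x| ≤ 6`. -/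
def vEx {N : ℕ} (s : ℝ) (x : EuclideanSpace ℝ (Fin N)) : ℝ :=
  if ‖x‖ < 5 then 1 else 1 - ((‖x‖ ^ 2 - 25) / 11) ^ s

lemma aux_div_zero {n : ℕ} (b : EuclideanSpace ℝ (Fin (n+1)) → ℝ)
    (b' : EuclideanSpace ℝ (Fin (n+1)) → (EuclideanSpace ℝ (Fin (n+1)) →L[ℝ] ℝ))
    (hd : ∀ x, x ≠ 0 → HasFDerivAt b (b' x) x)
    (hc : Continuous fun x => b x • x)
    (hs : HasCompactSupport b)
    (hi : Integrable fun x => ((n+1 : ℕ) : ℝ) * b x + b' x x) :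
    ∫ x, (((n+1 : ℕ) : ℝ) * b x + b' x x) = 0 := by
  obtain ⟨R, hR⟩ := hs.isCompact.isBounded.subset_closedBall (0 : EuclideanSpace ℝ (Fin (n+1)))
  have hout : ∀ x, R < ‖x‖ → b x = 0 ∧ b' x x = 0 := by
    intro x hx
    have hxs : x ∉ tsupport b := fun h => by
      have := hR h; simp at this; linarith
    refine ⟨image_eq_zero_of_notMem_tsupport hxs, ?_⟩
    by_cases h0 : x = 0
    · simp [h0]
    · have h1 := (hd x h0).fderiv
      have h2 : fderiv ℝ b x = 0 := by
        have := notMem_subset (tsupport_fderiv_subset ℝ (f := b)) hxs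
        exact image_eq_zero_of_notMem_tsupport this
      rw [← h1, h2]; simp
  set L : (Fin (n+1) → ℝ) ≃L[ℝ] EuclideanSpace ℝ (Fin (n+1)) :=
    (EuclideanSpace.equiv (Fin (n+1)) ℝ).symm with hL
  have hLi : ∀ y i, (L y) i = y i := fun y i => rfl
  have hLv : MeasurePreserving (L : (Fin (n+1) → ℝ) → EuclideanSpace ℝ (Fin (n+1))) volume volume :=
    PiLp.volume_preserving_toLp (Fin (n+1))
  have hLe : MeasurableEmbedding (L : (Fin (n+1) → ℝ) → EuclideanSpace ℝ (Fin (n+1))) :=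
    L.toHomeomorph.measurableEmbedding
  have hcoord : ∀ y i, |y i| ≤ ‖L y‖ := fun y i => by
    have := PiLp.norm_apply_le (L y) i
    simpa [hLi] using this
  let R' : ℝ := |R| + 1
  have hR' : R < R' := by have := le_abs_self R; simp only [R']; linarith
  have hR'0 : 0 < R' := by positivity
  let f : Fin (n+1) → (Fin (n+1) → ℝ) → ℝ := fun i y => b (L y) * y i
  let f' : Fin (n+1) → (Fin (n+1) → ℝ) → (Fin (n+1) → ℝ) →L[ℝ] ℝ := fun i y =>
    b (L y) • (ContinuousLinearMap.proj i : (Fin (n+1) → ℝ) →L[ℝ] ℝ) +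
      y i • ((b' (L y)).comp (L : (Fin (n+1) → ℝ) →L[ℝ] EuclideanSpace ℝ (Fin (n+1))))
  have hsum : ∀ y, ∑ i, f' i y (Pi.single i 1) = ((n+1 : ℕ) : ℝ) * b (L y) + b' (L y) (L y) := by
    intro y
    have hy : y = ∑ i, y i • (Pi.single i (1:ℝ) : Fin (n+1) → ℝ) := by
      ext j; simp [Finset.sum_apply, Pi.single_apply]
    have : b' (L y) (L y) = ∑ i, y i * b' (L y) (L (Pi.single i 1)) := by
      conv_lhs => rw [show (b' (L y)) (L y) = (b' (L y)) (L (∑ i, y i • (Pi.single i (1:ℝ) : Fin (n+1) → ℝ))) by rw [← hy]]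
      simp only [map_sum, map_smul, smul_eq_mul]
    rw [this]
    simp [f', Finset.sum_add_distrib]
  have hint : Integrable (fun y => ∑ i, f' i y (Pi.single i 1)) := by
    simp_rw [hsum]
    exact (hLv.integrable_comp_emb hLe).2 hi
  have key := integral_divergence_of_hasFDerivAt_off_countable' (fun _ => -R') (fun _ => R')
    (fun _ => by simp only; linarith) f f' {0} (countable_singleton 0)
    (by
      intro i
      have h1 : Continuous fun y => (b (L y) • L y) i :=
        (EuclideanSpace.proj (𝕜 := ℝ) i).continuous.comp (hc.comp L.continuous)
      exact h1.continuousOn)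
    (by
      intro y hy i
      have hy0 : L y ≠ 0 := fun h => hy.2 (by simpa using h)
      have h1 : HasFDerivAt (fun y => b (L y)) ((b' (L y)).comp (L : (Fin (n+1) → ℝ) →L[ℝ] EuclideanSpace ℝ (Fin (n+1)))) y :=
        (hd (L y) hy0).comp y L.hasFDerivAt
      have h2 : HasFDerivAt (fun y : Fin (n+1) → ℝ => y i) (ContinuousLinearMap.proj i : (Fin (n+1) → ℝ) →L[ℝ] ℝ) y :=
        (ContinuousLinearMap.proj i : (Fin (n+1) → ℝ) →L[ℝ] ℝ).hasFDerivAt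
      exact h1.mul h2)
    hint.integrableOn
  have hfz : ∀ i y, R' ≤ |y i| → f i y = 0 := fun i y h => by
    have := (hout (L y) (by have := hcoord y i; linarith)).1
    simp [f, this]
  rw [setIntegral_eq_integral_of_forall_compl_eq_zero] at key
  · simp_rw [hsum] at key
    rw [← hLv.integral_comp hLe, key]
    apply Finset.sum_eq_zero
    intro i _
    simp [hfz, abs_of_pos hR'0]
  · intro y hy
    rw [hsum]
    have : ∃ i, R' < |y i| := by
      by_contra! h
      exact hy ⟨fun i => (abs_le.1 (h i)).1, fun i => (abs_le.1 (h i)).2⟩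
    obtain ⟨i, hi⟩ := this
    obtain ⟨h1, h2⟩ := hout (L y) (by have := hcoord y i; linarith)
    simp [h1, h2]

lemma aux_pp_deriv {k : ℝ} (hk : 1 < k) (t : ℝ) :
    HasDerivAt (fun t : ℝ => max t 0 ^ k) (k * max t 0 ^ (k-1)) t := by
  have hR : ∀ t : ℝ, 0 ≤ t → HasDerivWithinAt (fun t : ℝ => max t 0 ^ k) (k * max t 0 ^ (k-1)) (Ici 0) t := by
    intro t ht
    have := (Real.hasDerivAt_rpow_const (x := t) (p := k) (Or.inr hk.le)).hasDerivWithinAt (s := Ici 0)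
    rw [max_eq_left ht]
    refine this.congr (fun y hy => ?_) ?_
    · rw [max_eq_left hy]
    · rw [max_eq_left ht]
  have hLf : ∀ t : ℝ, t ≤ 0 → HasDerivWithinAt (fun t : ℝ => max t 0 ^ k) (k * max t 0 ^ (k-1)) (Iic 0) t := by
    intro t ht
    rw [max_eq_right ht, Real.zero_rpow (by linarith), mul_zero]
    refine (hasDerivWithinAt_const t (Iic 0) (0:ℝ)).congr (fun y hy => ?_) ?_
    · rw [max_eq_right hy, Real.zero_rpow (by linarith)]
    · rw [max_eq_right ht, Real.zero_rpow (by linarith)]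
  rcases lt_trichotomy t 0 with h | h | h
  · exact (hLf t h.le).hasDerivAt (Iic_mem_nhds h)
  · subst h
    have := (hLf 0 le_rfl).union (hR 0 le_rfl)
    rwa [Iic_union_Ici, hasDerivWithinAt_univ] at this
  · exact (hR t h.le).hasDerivAt (Ici_mem_nhds h)

lemma aux_pp_cont {k : ℝ} (hk : 0 < k) : Continuous (fun t : ℝ => max t 0 ^ k) :=
  (continuous_id.max continuous_const).rpow_const fun _ => Or.inr hk.le

lemma aux_pp_contDiff {k : ℝ} (hk : 1 < k) : ContDiff ℝ 1 (fun t : ℝ => max t 0 ^ k) := by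
  rw [contDiff_one_iff_deriv]
  refine ⟨fun t => (aux_pp_deriv hk t).differentiableAt, ?_⟩
  have : deriv (fun t : ℝ => max t 0 ^ k) = fun t => k * max t 0 ^ (k-1) :=
    funext fun t => (aux_pp_deriv hk t).deriv
  rw [this]
  exact continuous_const.mul (aux_pp_cont (by linarith))

/-- the radial function and its derivative -/
lemma aux_rad_deriv {N : ℕ} {k : ℝ} (hk : 1 < k) (c d : ℝ) (x : EuclideanSpace ℝ (Fin N)) :
    HasFDerivAt (fun x : EuclideanSpace ℝ (Fin N) => max (c + d * ‖x‖^2) 0 ^ k)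
      ((2 * d * k * max (c + d * ‖x‖^2) 0 ^ (k-1)) • innerSL ℝ x) x := by
  have h1 : HasFDerivAt (fun x : EuclideanSpace ℝ (Fin N) => c + d * ‖x‖^2)
      (d • (2 • innerSL ℝ x)) x := by
    have := ((hasStrictFDerivAt_norm_sq x).hasFDerivAt.const_mul d).const_add c
    exact this
  have h2 := (aux_pp_deriv hk (c + d * ‖x‖^2)).comp_hasFDerivAt x h1
  refine h2.congr_fderiv ?_
  ext y
  simp
  ring

lemma aux_rad_contDiff {N : ℕ} {k : ℝ} (hk : 1 < k) (c d : ℝ) :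
    ContDiff ℝ 1 (fun x : EuclideanSpace ℝ (Fin N) => max (c + d * ‖x‖^2) 0 ^ k) :=
  (aux_pp_contDiff hk).comp (contDiff_const.add (contDiff_const.mul (contDiff_norm_sq ℝ)))

lemma aux_rad_cont {N : ℕ} {k : ℝ} (hk : 0 < k) (c d : ℝ) :
    Continuous (fun x : EuclideanSpace ℝ (Fin N) => max (c + d * ‖x‖^2) 0 ^ k) :=
  (aux_pp_cont hk).comp (by fun_prop)

lemma aux_sq_rpow {r : ℝ} (hr : 0 ≤ r) (e : ℝ) : (r^2)^e = r ^ (2*e) := by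
  rw [← Real.rpow_natCast r 2, ← Real.rpow_mul hr]; norm_num

lemma aux_field_cont {N : ℕ} {e : ℝ} (he : -1/2 < e) :
    Continuous (fun x : EuclideanSpace ℝ (Fin N) => ((‖x‖^2)^e) • x) := by
  rw [continuous_iff_continuousAt]
  intro x
  by_cases hx : x = 0
  · subst hx
    rw [ContinuousAt, smul_zero, tendsto_zero_iff_norm_tendsto_zero]
    have h : ∀ x : EuclideanSpace ℝ (Fin N), ‖((‖x‖^2)^e) • x‖ ≤ ‖x‖ ^ (2*e+1) := by
      intro x
      rcases eq_or_ne x 0 with rfl | h0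
      · simp; positivity
      · have : 0 < ‖x‖ := norm_pos_iff.2 h0
        rw [norm_smul, aux_sq_rpow this.le, Real.norm_of_nonneg (by positivity),
          Real.rpow_add_one this.ne']
    have h2 : Continuous fun x : EuclideanSpace ℝ (Fin N) => ‖x‖ ^ (2*e+1) :=
      continuous_norm.rpow_const fun _ => Or.inr (by linarith)
    have h3 := h2.tendsto 0
    rw [norm_zero, Real.zero_rpow (by linarith)] at h3
    exact squeeze_zero (fun _ => norm_nonneg _) h h3
  · have h1 : ContinuousAt (fun x : EuclideanSpace ℝ (Fin N) => ‖x‖^2) x := by fun_prop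
    have h2 := norm_pos_iff.2 hx
    have h3 : ContinuousAt (fun x : EuclideanSpace ℝ (Fin N) => (‖x‖^2)^e) x :=
      h1.rpow_const (Or.inl (by positivity))
    exact h3.smul continuousAt_id

lemma aux_field_locInt {n : ℕ} (hn : 2 ≤ n+1) {e : ℝ} (he : -1/2 < e) :
    LocallyIntegrable (fun x : EuclideanSpace ℝ (Fin (n+1)) => ((‖x‖^2)^e)) := by
  refine locallyIntegrable_of_norm_le_rpow (C := 1) (α := -(2*e)) (by simp) ?_ ?_ ?_
  · simp
    have : (2:ℝ) ≤ n + 1 := by exact_mod_cast hn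
    linarith
  · filter_upwards with x
    rw [aux_sq_rpow (norm_nonneg _), Real.norm_of_nonneg (by positivity)]
    simp
  · exact (by fun_prop : Measurable (fun x : EuclideanSpace ℝ (Fin (n+1)) => ((‖x‖^2)^e))).aestronglyMeasurable

lemma aux_ibp0 {n : ℕ} (hn : 2 ≤ n+1) {e k : ℝ} (he : -1/2 < e) (hk : 1 < k) (c d : ℝ)
    (φ : EuclideanSpace ℝ (Fin (n+1)) → ℝ) (hφ : ContDiff ℝ (⊤ : ℕ∞) φ) (hφs : HasCompactSupport φ) :
    Integrable (fun x => fderiv ℝ φ x ((max (c + d * ‖x‖^2) 0 ^ k * (‖x‖^2)^e) • x)) ∧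
    Integrable (fun x => φ x * ((((n+1 : ℕ) : ℝ) + 2 * e) * (max (c + d * ‖x‖^2) 0 ^ k * (‖x‖^2)^e)
      + 2 * d * k * (max (c + d * ‖x‖^2) 0 ^ (k-1) * (‖x‖^2 * (‖x‖^2)^e)))) ∧
    ∫ x, fderiv ℝ φ x ((max (c + d * ‖x‖^2) 0 ^ k * (‖x‖^2)^e) • x) =
    - ∫ x, φ x * ((((n+1 : ℕ) : ℝ) + 2 * e) * (max (c + d * ‖x‖^2) 0 ^ k * (‖x‖^2)^e)
      + 2 * d * k * (max (c + d * ‖x‖^2) 0 ^ (k-1) * (‖x‖^2 * (‖x‖^2)^e))) := by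
  have hφc := hφ.continuous
  have hM := aux_rad_cont (N := n+1) (k := k) (by linarith) c d
  have hM' := aux_rad_cont (N := n+1) (k := k-1) (by linarith) c d
  have hF := aux_field_cont (N := n+1) he
  have hLI := aux_field_locInt hn he
  have hF2 : Continuous fun x : EuclideanSpace ℝ (Fin (n+1)) =>
      (max (c + d * ‖x‖^2) 0 ^ k * (‖x‖^2)^e) • x := by
    simp_rw [mul_smul]; exact hM.smul hF
  have hI1 : Integrable (fun x => fderiv ℝ φ x ((max (c + d * ‖x‖^2) 0 ^ k * (‖x‖^2)^e) • x)) := by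
    apply Continuous.integrable_of_hasCompactSupport
    · exact (hφ.continuous_fderiv (by simp)).clm_apply hF2
    · refine (hφs.fderiv ℝ).mono ?_
      intro x hx h0
      apply hx
      simp [h0]
  have hI2 : Integrable (fun x => φ x * ((((n+1 : ℕ) : ℝ) + 2 * e) * (max (c + d * ‖x‖^2) 0 ^ k * (‖x‖^2)^e)
      + 2 * d * k * (max (c + d * ‖x‖^2) 0 ^ (k-1) * (‖x‖^2 * (‖x‖^2)^e)))) := by
    have hg : Continuous fun x => φ x * ((((n+1 : ℕ) : ℝ) + 2 * e) * (max (c + d * ‖x‖^2) 0 ^ k)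
      + 2 * d * k * (max (c + d * ‖x‖^2) 0 ^ (k-1) * (‖x‖^2))) := by
      fun_prop
    have := hLI.integrable_smul_left_of_hasCompactSupport hg (hφs.mul_right)
    refine this.congr (Filter.Eventually.of_forall fun x => ?_)
    simp only [smul_eq_mul]; ring
  refine ⟨hI1, hI2, ?_⟩
  let b : EuclideanSpace ℝ (Fin (n+1)) → ℝ := fun x => φ x * (max (c + d * ‖x‖^2) 0 ^ k * (‖x‖^2)^e)
  let b' : EuclideanSpace ℝ (Fin (n+1)) → EuclideanSpace ℝ (Fin (n+1)) →L[ℝ] ℝ := fun x =>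
    φ x • ((max (c + d * ‖x‖^2) 0 ^ k) • ((e * (‖x‖^2)^(e-1)) • (2 • innerSL ℝ x)) +
      ((‖x‖^2)^e) • ((2 * d * k * max (c + d * ‖x‖^2) 0 ^ (k-1)) • innerSL ℝ x))
     + (max (c + d * ‖x‖^2) 0 ^ k * (‖x‖^2)^e) • fderiv ℝ φ x
  have hb : ∀ x, ((n+1 : ℕ) : ℝ) * b x + b' x x =
     fderiv ℝ φ x ((max (c + d * ‖x‖^2) 0 ^ k * (‖x‖^2)^e) • x) +
     φ x * ((((n+1 : ℕ) : ℝ) + 2 * e) * (max (c + d * ‖x‖^2) 0 ^ k * (‖x‖^2)^e)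
      + 2 * d * k * (max (c + d * ‖x‖^2) 0 ^ (k-1) * (‖x‖^2 * (‖x‖^2)^e))) ∨ x = 0 := by
    intro x
    by_cases h0 : x = 0
    · exact Or.inr h0
    left
    have hρ : 0 < ‖x‖^2 := by have := norm_pos_iff.2 h0; positivity
    have h1 : (‖x‖^2)^e = (‖x‖^2)^(e-1) * ‖x‖^2 := by
      rw [← Real.rpow_add_one hρ.ne']; ring_nf
    simp only [b, b', add_apply, smul_apply, map_smul,
      innerSL_apply_apply, real_inner_self_eq_norm_sq, smul_eq_mul, nsmul_eq_mul]
    rw [h1]; push_cast; ring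
  have hae : (fun x => ((n+1 : ℕ) : ℝ) * b x + b' x x) =ᵐ[volume] fun x =>
     fderiv ℝ φ x ((max (c + d * ‖x‖^2) 0 ^ k * (‖x‖^2)^e) • x) +
     φ x * ((((n+1 : ℕ) : ℝ) + 2 * e) * (max (c + d * ‖x‖^2) 0 ^ k * (‖x‖^2)^e)
      + 2 * d * k * (max (c + d * ‖x‖^2) 0 ^ (k-1) * (‖x‖^2 * (‖x‖^2)^e))) := by
    have : ∀ᵐ x : EuclideanSpace ℝ (Fin (n+1)), x ≠ 0 := by
      simp [ae_iff, measure_singleton]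
    filter_upwards [this] with x hx
    exact (hb x).resolve_right hx
  have key := aux_div_zero b b' ?_ ?_ ?_ ((hI1.add hI2).congr hae.symm)
  · rw [integral_congr_ae hae, integral_add hI1 hI2] at key
    linarith
  · intro x h0
    have hρ : 0 < ‖x‖^2 := by have := norm_pos_iff.2 h0; positivity
    have h1 : HasFDerivAt (fun x : EuclideanSpace ℝ (Fin (n+1)) => (‖x‖^2)^e)
        ((e * (‖x‖^2)^(e-1)) • (2 • innerSL ℝ x)) x := by
      have h := Real.hasDerivAt_rpow_const (x := ‖x‖^2) (p := e) (Or.inl hρ.ne')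
      have h' : HasFDerivAt (fun x : EuclideanSpace ℝ (Fin (n+1)) => ‖x‖^2) (2 • innerSL ℝ x) x :=
        (hasStrictFDerivAt_norm_sq x).hasFDerivAt
      exact h.comp_hasFDerivAt x h'
    have h2 := (aux_rad_deriv hk c d x).mul h1
    exact ((hφ.differentiable (by simp)).differentiableAt.hasFDerivAt (x := x)).mul h2
  · have : Continuous fun x => φ x • ((max (c + d * ‖x‖^2) 0 ^ k * (‖x‖^2)^e) • x) := hφc.smul hF2
    simpa [b, mul_smul] using this
  · exact hφs.mul_right

lemma aux_ibp {n : ℕ} (hn : 2 ≤ n+1) {e k : ℝ} (he : -1/2 < e) (hk : 1 < k) (c d : ℝ)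
    (z : EuclideanSpace ℝ (Fin (n+1)))
    (φ : EuclideanSpace ℝ (Fin (n+1)) → ℝ) (hφ : ContDiff ℝ (⊤ : ℕ∞) φ) (hφs : HasCompactSupport φ) :
    Integrable (fun x => fderiv ℝ φ x ((max (c + d * ‖x - z‖^2) 0 ^ k * (‖x - z‖^2)^e) • (x - z))) ∧
    Integrable (fun x => φ x * ((((n+1 : ℕ) : ℝ) + 2 * e) * (max (c + d * ‖x - z‖^2) 0 ^ k * (‖x - z‖^2)^e)
      + 2 * d * k * (max (c + d * ‖x - z‖^2) 0 ^ (k-1) * (‖x - z‖^2 * (‖x - z‖^2)^e)))) ∧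
    ∫ x, fderiv ℝ φ x ((max (c + d * ‖x - z‖^2) 0 ^ k * (‖x - z‖^2)^e) • (x - z)) =
    - ∫ x, φ x * ((((n+1 : ℕ) : ℝ) + 2 * e) * (max (c + d * ‖x - z‖^2) 0 ^ k * (‖x - z‖^2)^e)
      + 2 * d * k * (max (c + d * ‖x - z‖^2) 0 ^ (k-1) * (‖x - z‖^2 * (‖x - z‖^2)^e))) := by
  have hd : ∀ x, fderiv ℝ (fun x => φ (x + z)) x = fderiv ℝ φ (x + z) := fun x =>
    fderiv_comp_add_right z
  obtain ⟨h1, h2, h3⟩ := aux_ibp0 hn he hk c d (fun x => φ (x + z))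
    (hφ.comp (contDiff_id.add contDiff_const))
    (hφs.comp_homeomorph (Homeomorph.addRight z))
  simp_rw [hd] at h1 h3
  have h1' := h1.comp_sub_right z
  have h2' := h2.comp_sub_right z
  rw [← integral_sub_right_eq_self _ z, ← integral_sub_right_eq_self (fun x => φ (x + z) * _) z] at h3
  simp only [sub_add_cancel] at h1' h2' h3
  exact ⟨h1', h2', h3⟩

def auxPsi (C A k e c d m : ℝ) : ℝ :=
  C * (A * (m ^ k * ((m - c) / d) ^ e) + 2 * d * k * (m ^ (k-1) * ((m - c) / d * ((m - c) / d) ^ e)))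

lemma auxPsi_zero {C A k e c d : ℝ} (hk : 1 < k) : auxPsi C A k e c d 0 = 0 := by
  simp [auxPsi, Real.zero_rpow (by linarith : k ≠ 0), Real.zero_rpow (by linarith : k - 1 ≠ 0)]

lemma auxPsi_max {C A k e c d ρ : ℝ} (hk : 1 < k) (hd : d ≠ 0) :
    auxPsi C A k e c d (max (c + d * ρ) 0) =
      C * (A * (max (c + d * ρ) 0 ^ k * ρ ^ e) +
        2 * d * k * (max (c + d * ρ) 0 ^ (k-1) * (ρ * ρ ^ e))) := by
  rcases le_total (c + d * ρ) 0 with h | h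
  · rw [max_eq_right h, auxPsi_zero hk]
    simp [Real.zero_rpow (by linarith : k ≠ 0), Real.zero_rpow (by linarith : k - 1 ≠ 0)]
  · rw [max_eq_left h, auxPsi]
    have : (c + d * ρ - c) / d = ρ := by field_simp; ring
    rw [this]

lemma auxPsi_cont {C A k e c d : ℝ} (hk : 1 < k) (S : Set ℝ) (g : ℝ → ℝ) (hg : ContinuousOn g S)
    (h : ∀ t ∈ S, 0 < (g t - c) / d) : ContinuousOn (fun t => auxPsi C A k e c d (g t)) S := by
  have h1 : ContinuousOn (fun t => g t ^ k) S := hg.rpow_const fun _ _ => Or.inr (by linarith)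
  have h2 : ContinuousOn (fun t => g t ^ (k-1)) S := hg.rpow_const fun _ _ => Or.inr (by linarith)
  have h3 : ContinuousOn (fun t => (g t - c) / d) S := (hg.sub continuousOn_const).div_const d
  have h4 : ContinuousOn (fun t => ((g t - c) / d)^e) S := h3.rpow_const fun t ht => Or.inl (h t ht).ne'
  exact continuousOn_const.mul ((continuousOn_const.mul (h1.mul h4)).add
    (continuousOn_const.mul (h2.mul (h3.mul h4))))

lemma auxPsi_smooth {C A k e c d : ℝ} (S : Set ℝ) (g : ℝ → ℝ) (hg : ContDiffOn ℝ (⊤ : ℕ∞) g S)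
    (h0 : ∀ t ∈ S, 0 < g t)
    (h : ∀ t ∈ S, 0 < (g t - c) / d) :
    ContDiffOn ℝ (⊤ : ℕ∞) (fun t => auxPsi C A k e c d (g t)) S := by
  have h1 : ContDiffOn ℝ (⊤ : ℕ∞) (fun t => g t ^ k) S := hg.rpow_const_of_ne fun t ht => (h0 t ht).ne'
  have h2 : ContDiffOn ℝ (⊤ : ℕ∞) (fun t => g t ^ (k-1)) S :=
    hg.rpow_const_of_ne fun t ht => (h0 t ht).ne'
  have h3 : ContDiffOn ℝ (⊤ : ℕ∞) (fun t => (g t - c) / d) S := (hg.sub contDiffOn_const).div_const d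
  have h4 : ContDiffOn ℝ (⊤ : ℕ∞) (fun t => ((g t - c) / d)^e) S :=
    h3.rpow_const_of_ne fun t ht => (h t ht).ne'
  exact contDiffOn_const.mul ((contDiffOn_const.mul (h1.mul h4)).add
    (contDiffOn_const.mul (h2.mul (h3.mul h4))))

lemma aux_gvec {N : ℕ} {p s κ M : ℝ} (hp : 1 < p) (hs : 1 < s) (hκ : 0 < κ) (hM : 0 ≤ M)
    (y : EuclideanSpace ℝ (Fin N)) :
    gvec (fun t : ℝ => t ^ (p-1)) ((-(κ * M^(s-1))) • y) =
      (-(κ^(p-1))) • ((M^((s-1)*(p-1)) * (‖y‖^2)^((p-2)/2)) • y) := by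
  have hk : 0 < (s-1)*(p-1) := mul_pos (by linarith) (by linarith)
  by_cases hy : y = 0
  · simp [hy, gvec]
  rcases hM.eq_or_lt with rfl | hM
  · simp [gvec, Real.zero_rpow (by linarith : s - 1 ≠ 0), Real.zero_rpow hk.ne']
  have hy' : 0 < ‖y‖ := norm_pos_iff.2 hy
  have ha : 0 < κ * M^(s-1) := by positivity
  rw [gvec, if_neg (smul_ne_zero (neg_ne_zero.2 ha.ne') hy), norm_smul, norm_neg,
    Real.norm_of_nonneg ha.le, smul_smul, smul_smul, aux_sq_rpow hy'.le]
  congr 1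
  have h1 : ‖y‖ ^ (p-1) = ‖y‖ ^ (2*((p-2)/2)) * ‖y‖ := by
    rw [← Real.rpow_add_one hy'.ne']; ring_nf
  rw [Real.mul_rpow ha.le hy'.le, Real.mul_rpow hκ.le (by positivity), ← Real.rpow_mul hM.le, h1]
  field_simp

lemma aux_not_radial {N : ℕ} (hN : 2 ≤ N) (a b : EuclideanSpace ℝ (Fin N)) (ha : a ≠ 0)
    (S : EuclideanSpace ℝ (Fin N) → Prop) (hS : ∀ x, S x → x = a ∨ x = b)
    (hr : ∀ x, ‖x‖ = ‖a‖ → S x) : False := by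
  have h1 : -a ≠ a := by
    intro h
    have h2 : (2:ℝ) • a = 0 := by
      rw [two_smul]; nth_rewrite 1 [← h]; simp
    exact ha ((smul_eq_zero.1 h2).resolve_left two_ne_zero)
  have h2 : -a = b := (hS _ (hr _ (norm_neg a))).resolve_left h1
  obtain ⟨y, hy, hy0⟩ : ∃ y ∈ (Submodule.span ℝ {a})ᗮ, y ≠ 0 := by
    apply Submodule.exists_mem_ne_zero_of_ne_bot
    intro h
    rw [Submodule.orthogonal_eq_bot_iff] at h
    have h3 := finrank_span_singleton (K := ℝ) ha
    rw [h, finrank_top] at h3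
    simp at h3
    omega
  have hay : ⟪a, y⟫ = 0 := Submodule.mem_orthogonal_singleton_iff_inner_right.1 hy
  have hy' := norm_pos_iff.2 hy0
  have hn : ‖(‖a‖ / ‖y‖) • y‖ = ‖a‖ := by
    rw [norm_smul, Real.norm_of_nonneg (by positivity)]; field_simp
  have hin : ⟪a, (‖a‖ / ‖y‖) • y⟫ = 0 := by rw [inner_smul_right, hay, mul_zero]
  rcases hS _ (hr _ hn) with h | h
  · rw [h] at hin; exact ha (inner_self_eq_zero.1 hin)
  · rw [h, ← h2, inner_neg_right, neg_eq_zero] at hin; exact ha (inner_self_eq_zero.1 hin)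

lemma aux_w_eq {N : ℕ} {s : ℝ} (hs : 1 < s) (x : EuclideanSpace ℝ (Fin N)) :
    wEx s x = max (1 + (-1) * ‖x‖^2) 0 ^ s := by
  have hx := norm_nonneg x
  unfold wEx
  split_ifs with h
  · rw [max_eq_left (by nlinarith)]; ring_nf
  · rw [max_eq_right (by nlinarith), Real.zero_rpow (by linarith)]

lemma aux_v_eq {N : ℕ} {s : ℝ} (hs : 1 < s) (x : EuclideanSpace ℝ (Fin N)) :
    vEx s x = 1 - max (-25/11 + (1/11) * ‖x‖^2) 0 ^ s := by
  have hx := norm_nonneg x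
  unfold vEx
  split_ifs with h
  · rw [max_eq_right (by nlinarith), Real.zero_rpow (by linarith)]; ring
  · rw [max_eq_left (by nlinarith)]; ring_nf

lemma aux_inner_grad {N : ℕ} (φ : EuclideanSpace ℝ (Fin N) → ℝ) (x v : EuclideanSpace ℝ (Fin N)) :
    ⟪v, gradient φ x⟫ = fderiv ℝ φ x v := by
  rw [real_inner_comm, gradient, InnerProductSpace.toDual_symm_apply]

lemma aux_grad {N : ℕ} {u : EuclideanSpace ℝ (Fin N) → ℝ} {x G : EuclideanSpace ℝ (Fin N)}
    (h : HasFDerivAt u (innerSL ℝ G) x) : gradient u x = G := by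
  apply HasGradientAt.gradient
  rw [hasGradientAt_iff_hasFDerivAt]
  exact h

lemma aux_int3 {N : ℕ} {f g h : EuclideanSpace ℝ (Fin N) → ℝ} (a b c : ℝ)
    (hf : Integrable f) (hg : Integrable g) (hh : Integrable h) :
    ∫ x, (a * f x + b * g x + c * h x) = a * (∫ x, f x) + b * (∫ x, g x) + c * ∫ x, h x := by
  have h1 : Integrable (fun x => a * f x + b * g x) := (hf.const_mul a).add (hg.const_mul b)
  rw [integral_add h1 (hh.const_mul c), integral_add (hf.const_mul a) (hg.const_mul b)]
  simp only [integral_const_mul]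

/-- Example 1.1: the function `u = v + w(· - x¹) + w(· - x²)` is a positive `C¹` weak
solution of a `p`-Laplace equation `-Δ_p u = f(u)` in `B₆` vanishing on `∂B₆`, for some
`f ∈ C[0,2) ∩ C^∞((0,1) ∪ (1,2))` with `f(1) = 0`, which is not radially symmetric. -/
theorem example_symmetry_breaking
    {N : ℕ} (hN : 2 ≤ N) (p s : ℝ) (hp : 1 < p) (hs : p / (p - 1) < s)
    (x₁ x₂ : EuclideanSpace ℝ (Fin N))
    (hx₁ : x₁ ∈ ball (0:EuclideanSpace ℝ (Fin N)) 4)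
    (hx₂ : x₂ ∈ ball (0:EuclideanSpace ℝ (Fin N)) 4)
    (hdist : 2 ≤ ‖x₁ - x₂‖)
    (u : EuclideanSpace ℝ (Fin N) → ℝ)
    (hu : ∀ x, u x = vEx s x + wEx s (x - x₁) + wEx s (x - x₂)) :
    ContDiffOn ℝ 1 u (closedBall 0 6) ∧
    (∀ x ∈ ball (0:EuclideanSpace ℝ (Fin N)) 6, 0 < u x) ∧
    (∀ x ∈ sphere (0:EuclideanSpace ℝ (Fin N)) 6, u x = 0) ∧
    (¬ ∃ U : ℝ → ℝ, ∀ x ∈ ball (0:EuclideanSpace ℝ (Fin N)) 6, u x = U ‖x‖) ∧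
    ∃ f : ℝ → ℝ, ContinuousOn f (Ico 0 2) ∧
      ContDiffOn ℝ (⊤ : ℕ∞) f (Ioo 0 1 ∪ Ioo 1 2) ∧ f 1 = 0 ∧
      IsDistribSolAut (ball (0:EuclideanSpace ℝ (Fin N)) 6) (fun t : ℝ => t ^ (p - 1)) f u := by
  obtain ⟨n, rfl⟩ : ∃ n, N = n + 1 := ⟨N - 1, by omega⟩
  have hp1 : 0 < p - 1 := by linarith
  have hsp : p < s * (p - 1) := (div_lt_iff₀ hp1).1 hs
  have hs1 : 1 < s := by
    by_contra! h
    nlinarith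
  have hs0 : s ≠ 0 := by linarith
  have hk : 1 < (s-1)*(p-1) := by nlinarith
  have he : -1/2 < (p-2)/2 := by linarith
  simp only [mem_ball_zero_iff] at hx₁ hx₂
  -- the three truncated quantities
  let M0 : EuclideanSpace ℝ (Fin (n+1)) → ℝ := fun x => max (-25/11 + (1/11) * ‖x‖^2) 0
  let M1 : EuclideanSpace ℝ (Fin (n+1)) → ℝ := fun x => max (1 + (-1) * ‖x - x₁‖^2) 0
  let M2 : EuclideanSpace ℝ (Fin (n+1)) → ℝ := fun x => max (1 + (-1) * ‖x - x₂‖^2) 0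
  have hM0 : ∀ x, 0 ≤ M0 x := fun x => le_max_right _ _
  have hM1 : ∀ x, 0 ≤ M1 x := fun x => le_max_right _ _
  have hM2 : ∀ x, 0 ≤ M2 x := fun x => le_max_right _ _
  have hue : ∀ x, u x = 1 - M0 x ^ s + M1 x ^ s + M2 x ^ s := fun x => by
    rw [hu, aux_v_eq hs1, aux_w_eq hs1, aux_w_eq hs1]
  have hM0z : ∀ x, ‖x‖ ≤ 5 → M0 x = 0 := fun x h =>
    max_eq_right (by have := norm_nonneg x; nlinarith)
  have hM1z : ∀ x, 1 ≤ ‖x - x₁‖ → M1 x = 0 := fun x h => max_eq_right (by nlinarith)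
  have hM2z : ∀ x, 1 ≤ ‖x - x₂‖ → M2 x = 0 := fun x h => max_eq_right (by nlinarith)
  have hn1 : ∀ x, ‖x‖ ≤ ‖x - x₁‖ + ‖x₁‖ := fun x => by
    have := norm_add_le (x - x₁) x₁; rwa [sub_add_cancel] at this
  have hn2 : ∀ x, ‖x‖ ≤ ‖x - x₂‖ + ‖x₂‖ := fun x => by
    have := norm_add_le (x - x₂) x₂; rwa [sub_add_cancel] at this
  have hn3 : ∀ x, 2 ≤ ‖x - x₁‖ + ‖x - x₂‖ := fun x => by
    have := norm_sub_le (x - x₂) (x - x₁)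
    rw [sub_sub_sub_cancel_left] at this; linarith
  have hcases : ∀ x, (M1 x = 0 ∧ M2 x = 0) ∨ (M0 x = 0 ∧ M2 x = 0) ∨ (M0 x = 0 ∧ M1 x = 0) := by
    intro x
    have h1 := hn1 x
    have h2 := hn2 x
    have h3 := hn3 x
    rcases le_or_gt 1 ‖x - x₁‖ with a | a
    · rcases le_or_gt 1 ‖x - x₂‖ with b | b
      · exact Or.inl ⟨hM1z x a, hM2z x b⟩
      · exact Or.inr (Or.inr ⟨hM0z x (by linarith), hM1z x a⟩)
    · exact Or.inr (Or.inl ⟨hM0z x (by linarith), hM2z x (by linarith)⟩)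
  have hz : (0:ℝ) ^ s = 0 := Real.zero_rpow hs0
  have hCD : ContDiff ℝ 1 u := by
    have h0 : ContDiff ℝ 1 (fun x => M0 x ^ s) := aux_rad_contDiff hs1 _ _
    have h1 : ContDiff ℝ 1 (fun x => M1 x ^ s) :=
      (aux_rad_contDiff hs1 1 (-1)).comp (contDiff_id.sub contDiff_const)
    have h2 : ContDiff ℝ 1 (fun x => M2 x ^ s) :=
      (aux_rad_contDiff hs1 1 (-1)).comp (contDiff_id.sub contDiff_const)
    rw [funext hue]
    exact ((contDiff_const.sub h0).add h1).add h2
  refine ⟨hCD.contDiffOn, ?_, ?_, ?_, ?_⟩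
  · intro x hx
    rw [mem_ball_zero_iff] at hx
    rw [hue]
    have h0 : M0 x < 1 := max_lt (by have := norm_nonneg x; nlinarith) one_pos
    have h1 : M0 x ^ s < 1 := Real.rpow_lt_one (hM0 x) h0 (by linarith)
    have h2 := Real.rpow_nonneg (hM1 x) s
    have h3 := Real.rpow_nonneg (hM2 x) s
    linarith
  · intro x hx
    rw [mem_sphere_zero_iff_norm] at hx
    have h1 := hn1 x
    have h2 := hn2 x
    rw [hue, hM1z x (by linarith), hM2z x (by linarith)]
    have : M0 x = 1 := by simp only [M0, hx]; norm_num
    rw [this, hz]; simp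
  · rintro ⟨U, hU⟩
    have hu1 : u x₁ = 2 := by
      rw [hue, hM0z x₁ (by linarith), hM2z x₁ (by linarith), hz]
      have : M1 x₁ = 1 := by simp [M1]
      rw [this]; norm_num
    have hu2 : u x₂ = 2 := by
      rw [hue, hM0z x₂ (by linarith), hM1z x₂ (by rw [norm_sub_rev]; linarith), hz]
      have : M2 x₂ = 1 := by simp [M2]
      rw [this]; norm_num
    have honly : ∀ x, u x = 2 → x = x₁ ∨ x = x₂ := by
      intro x hx
      rw [hue] at hx
      have hone : ∀ m : ℝ, 0 ≤ m → m ^ s = 1 → m = 1 := fun m h h' => by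
        have h2 := Real.rpow_rpow_inv h hs0
        rw [h', Real.one_rpow] at h2
        exact h2.symm
      rcases hcases x with ⟨a, b⟩ | ⟨a, b⟩ | ⟨a, b⟩
      · rw [a, b, hz] at hx
        have := Real.rpow_nonneg (hM0 x) s
        linarith
      · rw [a, b, hz] at hx
        left
        have h1 : M1 x = 1 := hone _ (hM1 x) (by linarith)
        by_contra hne
        have h2 : 0 < ‖x - x₁‖ := norm_pos_iff.2 (sub_ne_zero.2 hne)
        have : M1 x < 1 := max_lt (by nlinarith) one_pos
        linarith
      · rw [a, b, hz] at hx
        right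
        have h1 : M2 x = 1 := hone _ (hM2 x) (by linarith)
        by_contra hne
        have h2 : 0 < ‖x - x₂‖ := norm_pos_iff.2 (sub_ne_zero.2 hne)
        have : M2 x < 1 := max_lt (by nlinarith) one_pos
        linarith
    by_cases h0 : x₁ = 0
    · have h0' : x₂ ≠ 0 := by
        rintro rfl
        rw [h0] at hdist; simp at hdist; linarith
      refine aux_not_radial hN x₂ x₁ h0' (fun x => u x = 2) (fun x hx => (honly x hx).symm) ?_
      intro x hx
      show u x = 2
      rw [hU x (by rw [mem_ball_zero_iff]; linarith), hx,
        ← hU x₂ (by rw [mem_ball_zero_iff]; linarith), hu2]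
    · refine aux_not_radial hN x₁ x₂ h0 (fun x => u x = 2) (fun x hx => (honly x hx)) ?_
      intro x hx
      show u x = 2
      rw [hU x (by rw [mem_ball_zero_iff]; linarith), hx,
        ← hU x₁ (by rw [mem_ball_zero_iff]; linarith), hu1]
  -- the nonlinearity
  set k : ℝ := (s-1)*(p-1) with hkdef
  set e : ℝ := (p-2)/2 with hedef
  set A : ℝ := ((n+1 : ℕ) : ℝ) + 2 * e with hA
  set C0 : ℝ := (2 * (1/11) * s) ^ (p-1) with hC0
  set C1 : ℝ := (2 * s) ^ (p-1) with hC1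
  let ψ0 : ℝ → ℝ := auxPsi C0 A k e (-25/11) (1/11)
  let ψ1 : ℝ → ℝ := auxPsi C1 A k e 1 (-1)
  have hψ0 : ψ0 0 = 0 := auxPsi_zero hk
  have hψ1 : ψ1 0 = 0 := auxPsi_zero hk
  have hsi : 0 < s⁻¹ := by positivity
  have hzi : (0:ℝ) ^ s⁻¹ = 0 := Real.zero_rpow hsi.ne'
  refine ⟨fun t => ψ0 (max (1 - t) 0 ^ s⁻¹) + ψ1 (max (t - 1) 0 ^ s⁻¹), ?_, ?_, ?_, ?_⟩
  · refine ContinuousOn.add ?_ ?_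
    · refine auxPsi_cont hk _ _ ((aux_pp_cont hsi).comp (by fun_prop)).continuousOn ?_
      intro t ht
      have : 0 ≤ max (1 - t) 0 ^ s⁻¹ := Real.rpow_nonneg (le_max_right _ _) _
      apply div_pos _ (by norm_num)
      linarith
    · refine auxPsi_cont hk _ _ ((aux_pp_cont hsi).comp (by fun_prop)).continuousOn ?_
      intro t ht
      have : max (t - 1) 0 ^ s⁻¹ < 1 :=
        Real.rpow_lt_one (le_max_right _ _) (max_lt (by linarith [ht.2]) one_pos) hsi
      apply div_pos_of_neg_of_neg _ (by norm_num)
      linarith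
  · refine ContDiffOn.union_of_isOpen ?_ ?_ isOpen_Ioo isOpen_Ioo
    · have h1 : ContDiffOn ℝ (⊤ : ℕ∞) (fun t : ℝ => ψ0 ((1 - t) ^ s⁻¹)) (Ioo 0 1) := by
        have hpos : ∀ t ∈ Ioo (0:ℝ) 1, 0 < (1 - t) ^ s⁻¹ := fun t ht =>
          Real.rpow_pos_of_pos (by linarith [ht.2]) _
        refine auxPsi_smooth _ _ ?_ hpos ?_
        · exact (contDiff_const.sub contDiff_id).contDiffOn.rpow_const_of_ne
            fun t ht => by have := ht.2; simp only [id]; linarith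
        · intro t ht
          have := hpos t ht
          apply div_pos _ (by norm_num)
          linarith
      refine h1.congr ?_
      intro t ht
      rw [max_eq_left (by linarith [ht.2]), max_eq_right (by linarith [ht.2]), hzi, hψ1, add_zero]
    · have h1 : ContDiffOn ℝ (⊤ : ℕ∞) (fun t : ℝ => ψ1 ((t - 1) ^ s⁻¹)) (Ioo 1 2) := by
        have hpos : ∀ t ∈ Ioo (1:ℝ) 2, 0 < (t - 1) ^ s⁻¹ := fun t ht =>
          Real.rpow_pos_of_pos (by linarith [ht.1]) _
        refine auxPsi_smooth _ _ ?_ hpos ?_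
        · exact (contDiff_id.sub contDiff_const).contDiffOn.rpow_const_of_ne
            fun t ht => by have := ht.1; simp only [id]; linarith
        · intro t ht
          have : (t - 1) ^ s⁻¹ < 1 :=
            Real.rpow_lt_one (by linarith [ht.1]) (by linarith [ht.2]) hsi
          apply div_pos_of_neg_of_neg _ (by norm_num)
          linarith
      refine h1.congr ?_
      intro t ht
      rw [max_eq_right (by linarith [ht.1]), max_eq_left (by linarith [ht.1]), hzi, hψ0, zero_add]
  · simp [hzi, hψ0, hψ1]
  · rintro φ ⟨hφ, hφs, hφt⟩
    -- pointwise value of the nonlinearity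
    have hf : ∀ x, ψ0 (max (1 - u x) 0 ^ s⁻¹) + ψ1 (max (u x - 1) 0 ^ s⁻¹) =
        ψ0 (M0 x) + ψ1 (M1 x) + ψ1 (M2 x) := by
      intro x
      have g0 := Real.rpow_nonneg (hM0 x) s
      have g1 := Real.rpow_nonneg (hM1 x) s
      have g2 := Real.rpow_nonneg (hM2 x) s
      rcases hcases x with ⟨a, b⟩ | ⟨a, b⟩ | ⟨a, b⟩
      · have e1 : u x = 1 - M0 x ^ s := by rw [hue, a, b, hz]; ring
        rw [e1, max_eq_left (by linarith), max_eq_right (by linarith), hzi, a, b, hψ1,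
          sub_sub_cancel, Real.rpow_rpow_inv (hM0 x) hs0]; ring
      · have e1 : u x = 1 + M1 x ^ s := by rw [hue, a, b, hz]; ring
        rw [e1, max_eq_right (by linarith), max_eq_left (by linarith), hzi, a, b, hψ1, hψ0,
          add_sub_cancel_left, Real.rpow_rpow_inv (hM1 x) hs0]; ring
      · have e1 : u x = 1 + M2 x ^ s := by rw [hue, a, b, hz]; ring
        rw [e1, max_eq_right (by linarith), max_eq_left (by linarith), hzi, a, b, hψ1, hψ0,
          add_sub_cancel_left, Real.rpow_rpow_inv (hM2 x) hs0]; ring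
    -- gradient of u
    have hgrad : ∀ x, gradient u x = (-(2 * (1/11) * s * M0 x ^ (s-1))) • x
        + (-(2 * s * M1 x ^ (s-1))) • (x - x₁) + (-(2 * s * M2 x ^ (s-1))) • (x - x₂) := by
      intro x
      apply aux_grad
      have h0 := aux_rad_deriv hs1 (-25/11) (1/11) x
      have h1 := (aux_rad_deriv hs1 1 (-1) (x - x₁)).comp x ((hasFDerivAt_id x).sub_const x₁)
      have h2 := (aux_rad_deriv hs1 1 (-1) (x - x₂)).comp x ((hasFDerivAt_id x).sub_const x₂)
      have h3 := ((h0.const_sub 1).add h1).add h2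
      rw [funext hue]
      refine h3.congr_fderiv ?_
      ext y
      simp [M0, M1, M2, inner_smul_left, inner_sub_left]
    have hs1' : (0:ℝ) ^ (s-1) = 0 := Real.zero_rpow (by linarith)
    have hk' : (0:ℝ) ^ k = 0 := Real.zero_rpow (by linarith)
    have hflux : ∀ x, gvec (fun t : ℝ => t ^ (p-1)) (gradient u x) =
        (-C0) • ((M0 x ^ k * (‖x‖^2)^e) • x) + (-C1) • ((M1 x ^ k * (‖x - x₁‖^2)^e) • (x - x₁))
        + (-C1) • ((M2 x ^ k * (‖x - x₂‖^2)^e) • (x - x₂)) := by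
      intro x
      rw [hgrad]
      rcases hcases x with ⟨a, b⟩ | ⟨a, b⟩ | ⟨a, b⟩
      · rw [a, b, hs1', hk']
        simp only [mul_zero, neg_zero, zero_smul, add_zero, zero_mul, smul_zero]
        exact aux_gvec hp hs1 (by positivity) (hM0 x) x
      · rw [a, b, hs1', hk']
        simp only [mul_zero, neg_zero, zero_smul, add_zero, zero_add, zero_mul, smul_zero]
        exact aux_gvec hp hs1 (by positivity) (hM1 x) _
      · rw [a, b, hs1', hk']
        simp only [mul_zero, neg_zero, zero_smul, add_zero, zero_add, zero_mul, smul_zero]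
        exact aux_gvec hp hs1 (by positivity) (hM2 x) _
    obtain ⟨K0, L0, I0⟩ := aux_ibp0 hN he hk (-25/11) (1/11) φ hφ hφs
    obtain ⟨K1, L1, I1⟩ := aux_ibp hN he hk 1 (-1) x₁ φ hφ hφs
    obtain ⟨K2, L2, I2⟩ := aux_ibp hN he hk 1 (-1) x₂ φ hφ hφs
    rw [setIntegral_eq_integral_of_forall_compl_eq_zero,
      setIntegral_eq_integral_of_forall_compl_eq_zero]
    · have e1 : ∀ x, ⟪gvec (fun t : ℝ => t ^ (p-1)) (gradient u x), gradient φ x⟫ =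
          (-C0) * fderiv ℝ φ x ((M0 x ^ k * (‖x‖^2)^e) • x)
          + (-C1) * fderiv ℝ φ x ((M1 x ^ k * (‖x - x₁‖^2)^e) • (x - x₁))
          + (-C1) * fderiv ℝ φ x ((M2 x ^ k * (‖x - x₂‖^2)^e) • (x - x₂)) := by
        intro x
        rw [aux_inner_grad, hflux, map_add, map_add]
        refine congrArg₂ (· + ·) (congrArg₂ (· + ·) ?_ ?_) ?_ <;> exact map_smul (fderiv ℝ φ x) _ _
      have e2 : ∀ x, (ψ0 (max (1 - u x) 0 ^ s⁻¹) + ψ1 (max (u x - 1) 0 ^ s⁻¹)) * φ x =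
          C0 * (φ x * (A * (M0 x ^ k * (‖x‖^2)^e)
            + 2 * (1/11) * k * (M0 x ^ (k-1) * (‖x‖^2 * (‖x‖^2)^e))))
          + C1 * (φ x * (A * (M1 x ^ k * (‖x - x₁‖^2)^e)
            + 2 * (-1) * k * (M1 x ^ (k-1) * (‖x - x₁‖^2 * (‖x - x₁‖^2)^e))))
          + C1 * (φ x * (A * (M2 x ^ k * (‖x - x₂‖^2)^e)
            + 2 * (-1) * k * (M2 x ^ (k-1) * (‖x - x₂‖^2 * (‖x - x₂‖^2)^e)))) := by
        intro x
        have q0 : ψ0 (M0 x) = _ := auxPsi_max hk (by norm_num)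
        have q1 : ψ1 (M1 x) = _ := auxPsi_max hk (by norm_num)
        have q2 : ψ1 (M2 x) = _ := auxPsi_max hk (by norm_num)
        rw [hf, q0, q1, q2]
        simp only [M0, M1, M2]
        ring
      refine (integral_congr_ae (Filter.Eventually.of_forall e1)).trans ?_
      refine Eq.trans ?_ (integral_congr_ae (Filter.Eventually.of_forall e2)).symm
      refine (aux_int3 (-C0) (-C1) (-C1) K0 K1 K2).trans ?_
      refine Eq.trans ?_ (aux_int3 C0 C1 C1 L0 L1 L2).symm
      rw [I0, I1, I2]
      ring
    · intro x hx
      have : x ∉ tsupport φ := fun h => hx (hφt h)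
      rw [image_eq_zero_of_notMem_tsupport this, mul_zero]
    · intro x hx
      have h1 : x ∉ tsupport φ := fun h => hx (hφt h)
      have h2 : fderiv ℝ φ x = 0 := image_eq_zero_of_notMem_tsupport
        (notMem_subset (tsupport_fderiv_subset ℝ (f := φ)) h1)
      rw [aux_inner_grad, h2]; simp

end
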